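/- arXiv:1902.08557 — 2 statements merged into one kernel-verified Lean document; each statement's English description precedes it below -/
import Mathlib

section
/- Assume n is a multiple of t/r. Let α, β ∈ 𝔽_q with α ≠ 0 and α + β ≠ 0, and suppose there exist δ, γ ∈ 𝔽_q^* with α = δ^{[n]} and α + β = γ^{[n]}. Set u = vγ + (1−v)δ ∈ R^*. Then the monomial map Ψ_u : Rⁿ → Rⁿ, (c₀,…,c_{n−1}) ↦ (u^{[0]}c₀, u^{[1]}c₁, …, u^{[n−1]}c_{n−1}), is an R-linear Hamming-weight-preserving bijection that maps the set of skew (α+vβ)-constacyclic codes of length n over R (with respect to θ_r) bijectively onto the set of skew cyclic codes of length n over R; in particular every skew (α+vβ)-constacyclic code of length n over R is equivalent to a skew cyclic code of length n over R. -/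
open scoped BigOperators

/-- The ring `R = 𝔽_q + v 𝔽_q`, `v² = v`, realized concretely as `F × F`
via the `F`-algebra isomorphism `a + v b ↦ (a, a + b)`. -/
abbrev Rg (F : Type) := F × F

/-- The element `v` of `R`: under the identification above, `v = (0, 1)`. -/
def vv (F : Type) [Field F] : Rg F := (0, 1)

/-- The element `v • x + (1 - v) • y` of `Rⁿ`, for `x, y ∈ Fⁿ`. -/
def mix {F : Type} [Field F] {n : ℕ} (x y : Fin n → F) : Fin n → Rg F :=
  fun i => vv F * algebraMap F (Rg F) (x i) + (1 - vv F) * algebraMap F (Rg F) (y i)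

/-- `v A ⊕ (1 - v) B = {v a + (1-v) b : a ∈ A, b ∈ B}`. -/
def mixSet {F : Type} [Field F] {n : ℕ} (A B : Set (Fin n → F)) : Set (Fin n → Rg F) :=
  {c | ∃ x ∈ A, ∃ y ∈ B, c = mix x y}

/-- Euclidean dual (of an arbitrary subset). -/
def dualE {K : Type} [CommRing K] {n : ℕ} (C : Set (Fin n → K)) : Set (Fin n → K) :=
  {x | ∀ y ∈ C, ∑ i, x i * y i = 0}

/-- Hermitian dual w.r.t. a conjugation map. -/
def dualH {K : Type} [CommRing K] (conj : K → K) {n : ℕ} (C : Set (Fin n → K)) :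
    Set (Fin n → K) :=
  {x | ∀ y ∈ C, ∑ i, x i * conj (y i) = 0}

/-- The map `a + v b ↦ a ^ e + v * b ^ e` on `R` (i.e. the extension of `x ↦ x ^ e`
from `F` to `R`); used for `θ_r` (`e = p ^ r`) and for conjugation (`e = p ^ (t/2)`). -/
def thR (F : Type) [Field F] (e : ℕ) : Rg F → Rg F :=
  fun z => (z.1 ^ e, z.1 ^ e + (z.2 - z.1) ^ e)

/-- The skew `λ`-constacyclic shift
`(c₀, …, c_{n-1}) ↦ (λ θ(c_{n-1}), θ(c₀), …, θ(c_{n-2}))`. -/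
def skewShift {K : Type} [Mul K] (th : K → K) (lam : K) {n : ℕ} (c : Fin n → K) :
    Fin n → K :=
  fun i =>
    if (i : ℕ) = 0 then
      lam * th (c ⟨n - 1, Nat.sub_lt (Nat.lt_of_le_of_lt (Nat.zero_le _) i.isLt) Nat.one_pos⟩)
    else th (c ⟨(i : ℕ) - 1, Nat.lt_of_le_of_lt (Nat.sub_le _ _) i.isLt⟩)

/-- A set of words is skew `λ`-constacyclic if it is stable under the skew shift. -/
def SkewConsta {K : Type} [Mul K] (th : K → K) (lam : K) {n : ℕ}
    (C : Set (Fin n → K)) : Prop :=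
  ∀ c ∈ C, skewShift th lam c ∈ C

/-- `[i] = (p^{ri} - 1)/(p^r - 1) = 1 + p^r + ⋯ + p^{r(i-1)}` (so `[0] = 0`). -/
def brk (p r i : ℕ) : ℕ := ∑ j ∈ Finset.range i, p ^ (r * j)

/-- The monomial map `ψ_δ : (c₀, …, c_{n-1}) ↦ (δ^{[0]} c₀, …, δ^{[n-1]} c_{n-1})`. -/
def psi {K : Type} [Monoid K] (p r : ℕ) (δ : K) {n : ℕ} (c : Fin n → K) : Fin n → K :=
  fun i => δ ^ brk p r (i : ℕ) * c i

/-- A set is a linear code over `K` if it is (the carrier of) a `K`-submodule. -/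
def IsLinCode (K : Type) [Semiring K] {M : Type} [AddCommMonoid M] [Module K M]
    (S : Set M) : Prop :=
  ∃ C : Submodule K M, ↑C = S

/-- The Gray map `Φ(a + v b) = (a, a + b)`, componentwise; under the identification
`R = F × F` it is the canonical unzip `Rⁿ ≅ Fⁿ × Fⁿ`. -/
def gray {F : Type} [Field F] {n : ℕ} (c : Fin n → Rg F) : (Fin n → F) × (Fin n → F) :=
  (fun i => (c i).1, fun i => (c i).2)

/-- Euclidean dual in `F^{2n} ≅ Fⁿ × Fⁿ` w.r.t. the standard inner product. -/
def dualProd {F : Type} [Field F] {n : ℕ} (S : Set ((Fin n → F) × (Fin n → F))) :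
    Set ((Fin n → F) × (Fin n → F)) :=
  {x | ∀ y ∈ S, (∑ i, x.1 i * y.1 i) + (∑ i, x.2 i * y.2 i) = 0}

theorem brk_succ (p r i : ℕ) : brk p r (i + 1) = 1 + p ^ r * brk p r i := by
  simp only [brk, Finset.sum_range_succ', Finset.mul_sum, Nat.mul_succ, pow_add, mul_zero, pow_zero]
  rw [add_comm]
  exact congrArg _ (Finset.sum_congr rfl fun j _ => mul_comm _ _)

/-- In characteristic `p`, the map `thR F (p ^ r)` is an iterate of Frobenius on `F × F`. -/
theorem thR_eq_pow (F : Type) [Field F] (p r : ℕ) [Fact p.Prime] [CharP F p] :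
    thR F (p ^ r) = fun z => z ^ p ^ r := by
  funext z
  ext
  · rfl
  · simp [thR, sub_pow_char_pow]

/-- The monomial map `psi` for a unit, as a linear equivalence. -/
def psiEquiv {K : Type} [CommRing K] (p r n : ℕ) (u : Kˣ) : (Fin n → K) ≃ₗ[K] (Fin n → K) :=
  LinearEquiv.piCongrRight fun i => LinearEquiv.smulOfUnit (u ^ brk p r (i : ℕ))

theorem coe_psiEquiv {K : Type} [CommRing K] (p r n : ℕ) (u : Kˣ) :
    ⇑(psiEquiv p r n u) = psi p r (u : K) := by
  funext c i
  simp [psiEquiv, psi, LinearEquiv.smulOfUnit, Units.smul_def]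

/-- The map `psi` intertwines the two skew shifts, up to the scalar `u`. -/
theorem psi_skewShift {K : Type} [CommRing K] (p r : ℕ) (u : K) {n : ℕ} (c : Fin n → K) :
    psi p r u (skewShift (fun z => z ^ p ^ r) (u ^ brk p r n) c) =
      u • skewShift (fun z => z ^ p ^ r) 1 (psi p r u c) := by
  funext ⟨i, hi⟩
  have key (m : ℕ) : u ^ brk p r (m + 1) = u * (u ^ brk p r m) ^ p ^ r := by
    rw [brk_succ, pow_add, pow_one, mul_comm (p ^ r), pow_mul]
  rcases i with _ | i
  · obtain ⟨n, rfl⟩ : ∃ m, n = m + 1 := ⟨n - 1, by omega⟩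
    simp [psi, skewShift, key, mul_pow, mul_assoc, show brk p r 0 = 0 from rfl]
  · simp [psi, skewShift, key, mul_pow, mul_assoc]

theorem isLinCode_image_iff {K M N : Type} [Semiring K] [AddCommMonoid M] [AddCommMonoid N]
    [Module K M] [Module K N] (e : M ≃ₗ[K] N) (S : Set M) :
    IsLinCode K (e '' S) ↔ IsLinCode K S := by
  constructor
  · rintro ⟨C, hC⟩
    exact ⟨C.comap (e : M →ₗ[K] N), by
      rw [Submodule.comap_coe, hC]
      exact Set.preimage_image_eq S e.injective⟩
  · rintro ⟨C, rfl⟩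
    exact ⟨C.map (e : M →ₗ[K] N), by simp⟩

theorem skewConsta_image_psi_iff {K : Type} [CommRing K] (p r : ℕ) (u : Kˣ) {n : ℕ}
    (C : Submodule K (Fin n → K)) :
    SkewConsta (fun z => z ^ p ^ r) (1 : K) (psi p r (u : K) '' (C : Set (Fin n → K))) ↔
      SkewConsta (fun z => z ^ p ^ r) ((u : K) ^ brk p r n) (C : Set (Fin n → K)) := by
  rw [SkewConsta, Set.forall_mem_image, ← coe_psiEquiv]
  refine forall₂_congr fun c _ => ?_
  rw [← (psiEquiv p r n u).injective.mem_set_image (a := skewShift _ _ c), coe_psiEquiv,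
    psi_skewShift, ← coe_psiEquiv]
  exact ((C.map (psiEquiv p r n u : (Fin n → K) →ₗ[K] (Fin n → K))).smul_mem_iff_of_isUnit
    u.isUnit).symm

/-- with `α = δ^{[n]}`, `α + β = γ^{[n]}` and `u = vγ + (1-v)δ`, the
monomial map `Ψ_u` is an `R`-linear Hamming-weight-preserving bijection mapping the set
of skew `(α + vβ)`-constacyclic codes of length `n` over `R` bijectively onto the set of
skew cyclic codes of length `n` over `R`. -/
theorem stmt8 (p t r n : ℕ) (hp : p.Prime) (ht : 0 < t) (hr : r ∣ t) (hn : (t / r) ∣ n)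
    (F : Type) [Field F] [Fintype F] [DecidableEq F] (hF : Fintype.card F = p ^ t)
    (α β δ γ : F) (hα : α ≠ 0) (hαβ : α + β ≠ 0) (hδ : δ ≠ 0) (hγ : γ ≠ 0)
    (hαδ : α = δ ^ brk p r n) (hαβγ : α + β = γ ^ brk p r n)
    (u : Rg F)
    (hu : u = vv F * algebraMap F (Rg F) γ + (1 - vv F) * algebraMap F (Rg F) δ) :
    IsLinearMap (Rg F) (psi p r u (n := n)) ∧
    Function.Bijective (psi p r u (n := n)) ∧
    (∀ x : Fin n → Rg F, hammingNorm (psi p r u x) = hammingNorm x) ∧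
    Set.BijOn (Set.image (psi p r u))
      {S : Set (Fin n → Rg F) | IsLinCode (Rg F) S ∧
        SkewConsta (thR F (p ^ r))
          (algebraMap F (Rg F) α + vv F * algebraMap F (Rg F) β) S}
      {S : Set (Fin n → Rg F) | IsLinCode (Rg F) S ∧
        SkewConsta (thR F (p ^ r)) (1 : Rg F) S} := by
  have : Fact p.Prime := ⟨hp⟩
  have : CharP F p := charP_of_card_eq_prime_pow hF
  have hu' : u = (δ, γ) := by
    rw [hu]
    ext <;> simp [vv]
  have hlam : algebraMap F (Rg F) α + vv F * algebraMap F (Rg F) β = u ^ brk p r n := by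
    rw [hu']
    ext
    · simp [vv, hαδ]
    · simp [vv, hαβγ]
  obtain ⟨w, rfl⟩ : IsUnit u := by
    rw [hu', Prod.isUnit_iff]
    exact ⟨hδ.isUnit, hγ.isUnit⟩
  rw [hlam, thR_eq_pow]
  have hcode (S : Set (Fin n → Rg F)) :
      (IsLinCode (Rg F) (psi p r (w : Rg F) '' S) ∧
        SkewConsta (fun z => z ^ p ^ r) (1 : Rg F) (psi p r (w : Rg F) '' S)) ↔
      (IsLinCode (Rg F) S ∧ SkewConsta (fun z => z ^ p ^ r) ((w : Rg F) ^ brk p r n) S) := by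
    rw [← coe_psiEquiv, isLinCode_image_iff, coe_psiEquiv]
    refine and_congr_right ?_
    rintro ⟨C, rfl⟩
    exact skewConsta_image_psi_iff p r w C
  have hbij : Function.Bijective (psi p r (w : Rg F) (n := n)) := by
    rw [← coe_psiEquiv]
    exact (psiEquiv p r n w).bijective
  refine ⟨?_, hbij, fun x => ?_, fun S hS => (hcode S).2 hS, hbij.1.image_injective.injOn,
    fun S hS => ?_⟩
  · rw [← coe_psiEquiv]
    exact (psiEquiv p r n w : (Fin n → Rg F) →ₗ[Rg F] (Fin n → Rg F)).isLinear
  · exact hammingNorm_comp (fun (i : Fin n) (z : Rg F) => (w : Rg F) ^ brk p r (i : ℕ) * z)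
      (fun i => (w.isUnit.pow _).mul_right_injective) fun i => mul_zero _
  · obtain ⟨T, rfl⟩ := hbij.2.image_surjective S
    exact ⟨T, (hcode T).1 hS, rfl⟩
end

section
/- Assume p is odd, n is odd, and n is a multiple of t/r. Then every skew (1−2v)-constacyclic code of length n over R (with respect to θ_r) is equivalent both to a skew cyclic code and to a skew negacyclic code of length n over R: the monomial map Ψ_{1−2v} : (c₀,…,c_{n−1}) ↦ ((1−2v)^{[0]}c₀, …, (1−2v)^{[n−1]}c_{n−1}) is an R-linear Hamming-weight-preserving bijection mapping the set of skew (1−2v)-constacyclic codes of length n over R bijectively onto the set of skew cyclic codes, and the monomial map Ψ_{2v−1} maps it bijectively onto the set of skew negacyclic codes. -/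
open scoped BigOperators

/-- For odd `p`, the exponent `[i]` has the parity of `i`, so it may be replaced by `i` when
`δ² = 1`. -/
theorem pow_brk_eq_pow {K : Type} [CommRing K] {p r : ℕ} (hp : Odd p) {δ : K}
    (hδ : δ * δ = 1) (i : ℕ) : δ ^ brk p r i = δ ^ i := by
  induction i with
  | zero => simp [brk]
  | succ i ih =>
    obtain ⟨k, hk⟩ : Odd (p ^ (r * i)) := hp.pow
    have h : brk p r (i + 1) = brk p r i + p ^ (r * i) := by
      simp [brk, Finset.sum_range_succ]
    rw [h, pow_add, ih, hk, pow_succ, pow_succ, pow_mul, sq, hδ, one_pow, one_mul]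

theorem pow_mul_pow_self {K : Type} [CommRing K] {δ : K} (hδ : δ * δ = 1) (i : ℕ) :
    δ ^ i * δ ^ i = 1 := by
  rw [← mul_pow, hδ, one_pow]

theorem psi_involutive {K : Type} [CommRing K] {p r n : ℕ} (hp : Odd p) {δ : K}
    (hδ : δ * δ = 1) : Function.Involutive (psi p r δ (n := n)) := by
  intro c
  funext i
  simp only [psi, pow_brk_eq_pow hp hδ]
  rw [← mul_assoc, pow_mul_pow_self hδ, one_mul]

theorem isLinearMap_psi {K : Type} [CommRing K] (p r n : ℕ) (δ : K) :
    IsLinearMap K (psi p r δ (n := n)) where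
  map_add x y := by
    funext i
    simp [psi, mul_add]
  map_smul a x := by
    funext i
    simp [psi, mul_left_comm]

theorem hammingNorm_psi {K : Type} [CommRing K] [DecidableEq K] (p r : ℕ) {n : ℕ} {δ : K}
    (hδ : δ * δ = 1) (x : Fin n → K) : hammingNorm (psi p r δ x) = hammingNorm x := by
  have hu : IsUnit δ := IsUnit.of_mul_eq_one δ hδ
  simp [hammingNorm, psi, (hu.pow _).mul_right_eq_zero]

/-- The monomial map intertwines the skew `δλ`- and `λ`-constacyclic shifts up to the
scalar `δ`. -/
theorem skewShift_psi {K : Type} [CommRing K] {p r n : ℕ} (hp : Odd p) (hn : Odd n)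
    {δ : K} (hδ : δ * δ = 1) {th : K → K} (hth : ∀ x, th (δ * x) = δ * th x) (lam : K)
    (c : Fin n → K) :
    skewShift th lam (psi p r δ c) = δ • psi p r δ (skewShift th (δ * lam) c) := by
  have hpow (k : ℕ) (x : K) : th (δ ^ k * x) = δ ^ k * th x := by
    induction k with
    | zero => simp
    | succ k ih => rw [pow_succ', mul_assoc, hth, ih, mul_assoc]
  funext i
  simp only [skewShift, psi, pow_brk_eq_pow hp hδ, Pi.smul_apply, smul_eq_mul, hpow]
  split_ifs with hi
  · have hpow_pred : δ ^ (n - 1) = 1 := by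
      obtain ⟨k, rfl⟩ := hn
      rw [Nat.add_sub_cancel, pow_mul, sq, hδ, one_pow]
    rw [hpow_pred, hi, pow_zero, one_mul, one_mul, mul_assoc, ← mul_assoc δ δ, hδ, one_mul]
  · have hpow_pred : δ ^ ((i : ℕ) - 1) = δ * δ ^ (i : ℕ) := by
      rw [← mul_pow_sub_one hi δ, ← mul_assoc, hδ, one_mul]
    rw [hpow_pred, mul_assoc]

theorem mapsTo_image_psi {K : Type} [CommRing K] {p r n : ℕ} (hp : Odd p) (hn : Odd n)
    {δ : K} (hδ : δ * δ = 1) {th : K → K} (hth : ∀ x, th (δ * x) = δ * th x) (lam : K) :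
    Set.MapsTo (Set.image (psi p r δ))
      {S : Set (Fin n → K) | IsLinCode K S ∧ SkewConsta th (δ * lam) S}
      {S : Set (Fin n → K) | IsLinCode K S ∧ SkewConsta th lam S} := by
  rintro _ ⟨⟨C, rfl⟩, hC⟩
  refine ⟨⟨C.map ((isLinearMap_psi p r n δ).mk' _), Submodule.map_coe _ _⟩, ?_⟩
  rintro _ ⟨c, hc, rfl⟩
  refine ⟨δ • skewShift th (δ * lam) c, C.smul_mem δ (hC c hc), ?_⟩
  rw [(isLinearMap_psi p r n δ).map_smul, skewShift_psi hp hn hδ hth]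

theorem bijOn_image_psi {K : Type} [CommRing K] {p r n : ℕ} (hp : Odd p) (hn : Odd n)
    {δ : K} (hδ : δ * δ = 1) {th : K → K} (hth : ∀ x, th (δ * x) = δ * th x)
    {lam mu : K} (hmu : mu = δ * lam) :
    Set.BijOn (Set.image (psi p r δ))
      {S : Set (Fin n → K) | IsLinCode K S ∧ SkewConsta th mu S}
      {S : Set (Fin n → K) | IsLinCode K S ∧ SkewConsta th lam S} := by
  have hinv (S : Set (Fin n → K)) : psi p r δ '' (psi p r δ '' S) = S := by
    rw [← Set.image_comp, (psi_involutive hp hδ).comp_self, Set.image_id]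
  have hlam : lam = δ * mu := by rw [hmu, ← mul_assoc, hδ, one_mul]
  have h₁ := mapsTo_image_psi (r := r) hp hn hδ hth lam
  have h₂ := mapsTo_image_psi (r := r) hp hn hδ hth mu
  rw [← hmu] at h₁
  rw [← hlam] at h₂
  exact Set.InvOn.bijOn ⟨fun S _ => hinv S, fun S _ => hinv S⟩ h₁ h₂

theorem thR_mul {F : Type} [Field F] {p : ℕ} [Fact p.Prime] [CharP F p] (k : ℕ)
    (x y : Rg F) : thR F (p ^ k) (x * y) = thR F (p ^ k) x * thR F (p ^ k) y := by
  ext <;> simp [thR, sub_pow_char_pow, mul_pow]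

theorem thR_of_sq_eq_one {F : Type} [Field F] {p : ℕ} [Fact p.Prime] [CharP F p]
    (hp : Odd p) (k : ℕ) {δ : Rg F} (hδ : δ * δ = 1) : thR F (p ^ k) δ = δ := by
  have h (a : F) (ha : a * a = 1) : a ^ p ^ k = a := by
    obtain ⟨m, hm⟩ : Odd (p ^ k) := hp.pow
    rw [hm, pow_succ, pow_mul, sq, ha, one_pow, one_mul]
  ext
  · simpa [thR] using h _ (congrArg Prod.fst hδ)
  · simpa [thR, sub_pow_char_pow] using h _ (congrArg Prod.snd hδ)

/-- for `p`, `n` odd (`n` a multiple of `t/r`), `Ψ_{1-2v}` is an `R`-linear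
Hamming-weight-preserving bijection mapping the set of skew `(1-2v)`-constacyclic codes of
length `n` over `R` bijectively onto the set of skew cyclic codes, and `Ψ_{2v-1}` maps it
bijectively onto the set of skew negacyclic codes. -/
theorem stmt10 (p t r n : ℕ) (hp : p.Prime) (hpodd : Odd p) (ht : 0 < t) (hr : r ∣ t)
    (hnodd : Odd n) (hn : (t / r) ∣ n)
    (F : Type) [Field F] [Fintype F] [DecidableEq F] (hF : Fintype.card F = p ^ t)
    (u : Rg F) (hu : u = 1 - 2 * vv F) :
    IsLinearMap (Rg F) (psi p r u (n := n)) ∧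
    Function.Bijective (psi p r u (n := n)) ∧
    (∀ x : Fin n → Rg F, hammingNorm (psi p r u x) = hammingNorm x) ∧
    Set.BijOn (Set.image (psi p r u))
      {S : Set (Fin n → Rg F) | IsLinCode (Rg F) S ∧ SkewConsta (thR F (p ^ r)) u S}
      {S : Set (Fin n → Rg F) | IsLinCode (Rg F) S ∧
        SkewConsta (thR F (p ^ r)) (1 : Rg F) S} ∧
    IsLinearMap (Rg F) (psi p r (-u) (n := n)) ∧
    Function.Bijective (psi p r (-u) (n := n)) ∧
    (∀ x : Fin n → Rg F, hammingNorm (psi p r (-u) x) = hammingNorm x) ∧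
    Set.BijOn (Set.image (psi p r (-u)))
      {S : Set (Fin n → Rg F) | IsLinCode (Rg F) S ∧ SkewConsta (thR F (p ^ r)) u S}
      {S : Set (Fin n → Rg F) | IsLinCode (Rg F) S ∧
        SkewConsta (thR F (p ^ r)) (-1 : Rg F) S} := by
  have : Fact p.Prime := ⟨hp⟩
  have : CharP F p := charP_of_card_eq_prime_pow hF
  have huu : u * u = 1 := by
    subst hu
    ext <;> simp [vv]
    ring
  have hneg : -u * -u = 1 := by rw [neg_mul_neg, huu]
  have hth {δ : Rg F} (hδ : δ * δ = 1) (x : Rg F) :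
      thR F (p ^ r) (δ * x) = δ * thR F (p ^ r) x := by
    rw [thR_mul, thR_of_sq_eq_one hpodd r hδ]
  exact ⟨isLinearMap_psi p r n u, (psi_involutive hpodd huu).bijective,
    hammingNorm_psi p r huu, bijOn_image_psi hpodd hnodd huu (hth huu) (mul_one u).symm,
    isLinearMap_psi p r n (-u), (psi_involutive hpodd hneg).bijective,
    hammingNorm_psi p r hneg, bijOn_image_psi hpodd hnodd hneg (hth hneg) (by simp)⟩
end
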